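/- Let n ≥ 3 and let m be a natural number with m ≤ n, and let ρ ∈ ℝ. Define λ : Fin n → ℝ by λ i = 0 if (i : ℕ) < m and λ i = ρ otherwise, and define S : Fin n → Fin n → ℝ by S i j := ((n−1)(λ i + λ j) − (n−m)ρ)/((n−1)(n−2)). Then ∑_{i < j} S i j · (λ i − λ j)² = m(m−1)(n−m)ρ³/((n−1)(n−2)). -/

import Mathlib

/-- The number of indices in `Fin n` below `m ≤ n` is `m`, as a sum of indicators. -/
lemma sum_indicator_val_lt {n m : ℕ} (hm : m ≤ n) :
    ∑ i : Fin n, (if (i : ℕ) < m then (1 : ℝ) else 0) = m := by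
  rw [Finset.sum_boole, Fin.card_filter_val_lt, min_eq_right hm]


/-- Closed-form evaluation of the Berger sum `∑_{i<j} R_{ijij}(λ_i − λ_j)²` when the
Ricci eigenvalues are `0` with multiplicity `m` and `ρ` with multiplicity `n − m`. -/
theorem stmt_6 (n m : ℕ) (hn : 3 ≤ n) (hm : m ≤ n) (ρ : ℝ)
    (lam : Fin n → ℝ) (hlam : ∀ i, lam i = if (i : ℕ) < m then 0 else ρ)
    (S : Fin n → Fin n → ℝ)
    (hS : ∀ i j, S i j
      = (((n : ℝ) - 1) * (lam i + lam j) - ((n : ℝ) - (m : ℝ)) * ρ)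
          / (((n : ℝ) - 1) * ((n : ℝ) - 2))) :
    ∑ i, ∑ j, (if i < j then S i j * (lam i - lam j) ^ 2 else 0)
      = (m : ℝ) * ((m : ℝ) - 1) * ((n : ℝ) - (m : ℝ)) * ρ ^ 3
          / (((n : ℝ) - 1) * ((n : ℝ) - 2)) := by
  set C : ℝ := ((m : ℝ) - 1) * ρ ^ 3 / (((n : ℝ) - 1) * ((n : ℝ) - 2)) with hC
  have hterm : ∀ i j : Fin n, (if i < j then S i j * (lam i - lam j) ^ 2 else 0)
      = (if (i : ℕ) < m then (1 : ℝ) else 0) * ((1 - if (j : ℕ) < m then (1 : ℝ) else 0) * C) := by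
    intro i j
    rw [hS, hlam i, hlam j, hC]
    by_cases hi : (i : ℕ) < m <;> by_cases hj : (j : ℕ) < m
    · simp [hi, hj]
    · have hij : i < j := Fin.lt_def.mpr (by omega)
      simp only [hi, hj, hij, if_true, if_false]
      ring
    · have hij : ¬ i < j := fun h => by
        have := Fin.lt_def.mp h
        omega
      simp [hi, hij]
    · simp [hi, hj]
  simp_rw [hterm, ← Finset.mul_sum, ← Finset.sum_mul, Finset.sum_sub_distrib,
    sum_indicator_val_lt hm]
  simp only [Finset.sum_const, Finset.card_univ, Fintype.card_fin, nsmul_eq_mul, mul_one]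
  rw [hC]
  ring
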